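/- arXiv:math/0611635 — 2 statements merged into one kernel-verified Lean document; each statement's English description precedes it below -/
import Mathlib

section
/- Conversely (Bobkov–Götze), if for every bounded 1-Lipschitz f: E → ℝ and all λ > 0, E^μ e^{λ(f - μ(f))} ≤ e^{Kλ²/2}, then μ satisfies W₁(ν,μ) ≤ √(2K h(ν|μ)) for all probability measures ν on E. -/
open MeasureTheory
open scoped ENNReal

/-- The `L¹`-Wasserstein distance between two probability measures on a metric space,
defined as the infimum of `∫ d(x,y) dπ` over couplings `π`. -/
noncomputable def wassersteinOne {E : Type*} [MeasurableSpace E] [MetricSpace E]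
    (ν μ : Measure E) : ℝ :=
  sInf {r : ℝ | ∃ π : Measure (E × E), IsProbabilityMeasure π ∧
    π.map Prod.fst = ν ∧ π.map Prod.snd = μ ∧ r = ∫ q, dist q.1 q.2 ∂π}

open scoped Classical in
/-- The relative entropy `h(ν|μ) = ∫ (dν/dμ) log(dν/dμ) dμ` (valued in `[0,∞]`,
equal to `+∞` when `ν` is not absolutely continuous w.r.t. `μ` or the integral diverges). -/
noncomputable def relEnt {E : Type*} [MeasurableSpace E] (ν μ : Measure E) : ℝ≥0∞ :=
  if ν ≪ μ ∧ Integrable (llr ν μ) ν then ENNReal.ofReal (∫ x, llr ν μ x ∂ν) else ⊤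

open ProbabilityTheory Set Filter

open scoped Topology

/-- Finite-dimensional Kantorovich duality for weights: if `∑ φ p + ∑ ψ q ≤ M` for all pairs with
`φ i + ψ j ≤ c i j`, then some coupling of `p` and `q` has cost at most `M`. -/
lemma exists_weights_cost_le {ι : Type*} [Fintype ι] (p q : ι → ℝ)
    (hp : p ∈ stdSimplex ℝ ι) (hq : q ∈ stdSimplex ℝ ι) (c : ι → ι → ℝ) (M : ℝ)
    (h : ∀ φ ψ : ι → ℝ, (∀ i j, φ i + ψ j ≤ c i j) → ∑ i, φ i * p i + ∑ j, ψ j * q j ≤ M) :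
    ∃ w ∈ stdSimplex ℝ (ι × ι), (∀ i, ∑ j, w (i, j) = p i) ∧ (∀ j, ∑ i, w (i, j) = q j) ∧
      ∑ z, w z * c z.1 z.2 ≤ M := by
  classical
  by_contra! hno
  let A : (ι × ι → ℝ) →ₗ[ℝ] (ι → ℝ) × (ι → ℝ) × ℝ :=
    { toFun := fun w => (fun i => ∑ j, w (i, j), fun j => ∑ i, w (i, j), ∑ z, w z * c z.1 z.2)
      map_add' := fun v w => by
        ext <;> simp [Finset.sum_add_distrib, add_mul]
      map_smul' := fun r w => by
        ext <;> simp [Finset.mul_sum, mul_assoc] }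
  have hA : Continuous A := A.continuous_of_finiteDimensional
  obtain ⟨G, u, v, hu, huv, hv⟩ := geometric_hahn_banach_compact_closed
    (s := A '' stdSimplex ℝ (ι × ι)) (t := {p} ×ˢ ({q} ×ˢ Iic M))
    ((convex_stdSimplex ℝ (ι × ι)).linear_image A) ((isCompact_stdSimplex ℝ (ι × ι)).image hA)
    ((convex_singleton p).prod ((convex_singleton q).prod (convex_Iic M)))
    (isClosed_singleton.prod (isClosed_singleton.prod isClosed_Iic))
    (by
      rw [Set.disjoint_left]
      rintro _ ⟨w, hw, rfl⟩ ⟨h1, h2, h3⟩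
      exact absurd h3 (not_le.2 (hno w hw (congrFun h1) (congrFun h2))))
  set φ : ι → ℝ := fun i => G (Pi.single i 1, 0, 0) with hφ
  set ψ : ι → ℝ := fun i => G (0, Pi.single i 1, 0) with hψ
  set α : ℝ := G (0, 0, 1) with hα
  have hG : ∀ a b r, G (a, b, r) = ∑ i, φ i * a i + ∑ j, ψ j * b j + α * r := by
    intro a b r
    have e1 : (a, b, r) = ∑ i, a i • ((Pi.single i 1, 0, 0) : (ι → ℝ) × (ι → ℝ) × ℝ)
        + ∑ j, b j • ((0, Pi.single j 1, 0) : (ι → ℝ) × (ι → ℝ) × ℝ)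
        + r • ((0, 0, 1) : (ι → ℝ) × (ι → ℝ) × ℝ) := by
      ext <;> simp [Prod.fst_sum, Prod.snd_sum, Pi.single_apply]
    rw [e1]
    simp only [map_add, map_sum, map_smul, smul_eq_mul, hφ, hψ, hα, mul_comm]
  have hpt : ∀ i j, φ i + ψ j + α * c i j < u := by
    intro i j
    have := hu _ (mem_image_of_mem A (single_mem_stdSimplex ℝ (i, j)))
    rw [show A (Pi.single (i, j) 1) = (Pi.single i 1, Pi.single j 1, c i j) by
      ext <;> simp [A, Pi.single_apply, Fintype.sum_prod_type, ite_and], hG] at this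
    simpa [Pi.single_apply] using this
  have hM : ∀ r ≤ M, v < ∑ i, φ i * p i + ∑ j, ψ j * q j + α * r := fun r hr => by
    rw [← hG]; exact hv _ ⟨rfl, rfl, hr⟩
  set S := ∑ i, φ i * p i + ∑ j, ψ j * q j with hS
  have hα0 : α ≤ 0 := by
    by_contra! hpos
    have h1 := hM (min M ((v - S) / α)) (min_le_left _ _)
    have h2 : α * min M ((v - S) / α) ≤ α * ((v - S) / α) := by gcongr; exact min_le_right _ _
    rw [mul_div_cancel₀ _ hpos.ne'] at h2
    linarith
  have hSu : S + α * ∑ z : ι × ι, p z.1 * q z.2 * c z.1 z.2 < u := by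
    have hmem : (fun z : ι × ι => p z.1 * q z.2) ∈ stdSimplex ℝ (ι × ι) := by
      refine ⟨fun z => mul_nonneg (hp.1 _) (hq.1 _), ?_⟩
      rw [Fintype.sum_prod_type]
      simp [← Finset.mul_sum, hq.2, hp.2]
    have := hu _ (mem_image_of_mem A hmem)
    rw [show A (fun z : ι × ι => p z.1 * q z.2) =
      (p, q, ∑ z : ι × ι, p z.1 * q z.2 * c z.1 z.2) by
        ext <;> simp [A, ← Finset.mul_sum, ← Finset.sum_mul, hq.2, hp.2], hG] at this
    exact this
  have hαneg : α < 0 := by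
    refine lt_of_le_of_ne hα0 fun h0 => ?_
    have := hM M le_rfl
    rw [h0] at this hSu
    linarith
  have hfin := h (fun i => (φ i - u) / (-α)) (fun j => ψ j / (-α)) (fun i j => by
    rw [← add_div, div_le_iff₀ (by linarith)]
    linarith [hpt i j])
  have e2 : ∑ i, (φ i - u) / (-α) * p i + ∑ j, ψ j / (-α) * q j = (S - u) / (-α) := by
    have : ∑ i, u * p i = u := by rw [← Finset.mul_sum, hp.2, mul_one]
    simp only [div_mul_eq_mul_div, ← Finset.sum_div, sub_mul, Finset.sum_sub_distrib, this, hS]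
    ring
  rw [e2, div_le_iff₀ (by linarith)] at hfin
  linarith [hM M le_rfl]

/-- Kantorovich duality on a finite space. -/
lemma exists_coupling_integral_le_of_finite {ι : Type*} [Fintype ι] [MeasurableSpace ι]
    [MeasurableSingletonClass ι] (P Q : Measure ι) [IsProbabilityMeasure P]
    [IsProbabilityMeasure Q] (c : ι → ι → ℝ) (M : ℝ)
    (h : ∀ φ ψ : ι → ℝ, (∀ i j, φ i + ψ j ≤ c i j) → ∫ i, φ i ∂P + ∫ j, ψ j ∂Q ≤ M) :
    ∃ π : Measure (ι × ι), IsProbabilityMeasure π ∧ π.map Prod.fst = P ∧ π.map Prod.snd = Q ∧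
      ∫ z, c z.1 z.2 ∂π ≤ M := by
  classical
  have hmem : ∀ (R : Measure ι) [IsProbabilityMeasure R],
      (fun i => R.real {i}) ∈ stdSimplex ℝ ι := by
    intro R _
    exact ⟨fun _ => measureReal_nonneg, by simp [sum_measureReal_singleton]⟩
  obtain ⟨w, hw, hw1, hw2, hwM⟩ := exists_weights_cost_le _ _ (hmem P) (hmem Q) c M
    fun φ ψ hφψ => by
      have := h φ ψ hφψ
      rw [integral_fintype .of_finite, integral_fintype .of_finite] at this
      simpa [mul_comm] using this
  let π : Measure (ι × ι) := ∑ z, ENNReal.ofReal (w z) • Measure.dirac z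
  have hπ : ∀ z, π {z} = ENNReal.ofReal (w z) := fun z => by
    simp [π, Measure.finsetSum_apply, indicator_apply]
  have hprob : IsProbabilityMeasure π := ⟨by
    rw [← Finset.coe_univ, ← sum_measure_singleton]
    simp only [hπ]
    rw [← ENNReal.ofReal_sum_of_nonneg fun z _ => hw.1 z, hw.2, ENNReal.ofReal_one]⟩
  have hπr : ∀ z, π.real {z} = w z := fun z => by
    rw [measureReal_def, hπ, ENNReal.toReal_ofReal (hw.1 z)]
  refine ⟨π, hprob, ?_, ?_, ?_⟩
  · have := Measure.isProbabilityMeasure_map (μ := π) measurable_fst.aemeasurable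
    refine ext_iff_measureReal_singleton.2 fun i => ?_
    rw [map_measureReal_apply measurable_fst (measurableSet_singleton i), ← hw1 i,
      show (Prod.fst ⁻¹' {i} : Set (ι × ι)) = (({i} ×ˢ Finset.univ : Finset (ι × ι)) : Set _) by
        ext ⟨a, b⟩; simp [eq_comm], ← sum_measureReal_singleton, Finset.sum_product]
    simp [hπr]
  · have := Measure.isProbabilityMeasure_map (μ := π) measurable_snd.aemeasurable
    refine ext_iff_measureReal_singleton.2 fun i => ?_
    rw [map_measureReal_apply measurable_snd (measurableSet_singleton i), ← hw2 i,
      show (Prod.snd ⁻¹' {i} : Set (ι × ι)) = ((Finset.univ ×ˢ {i} : Finset (ι × ι)) : Set _) by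
        ext ⟨a, b⟩; simp [eq_comm], ← sum_measureReal_singleton, Finset.sum_product]
    simp [hπr]
  · rw [integral_fintype .of_finite]
    simpa [hπr] using hwM

/-- A coupling of the images of `ν` and `μ` under `T` lifts to a coupling of the laws of
`(T, id)` under `ν` and `μ`. -/
lemma exists_lift_coupling {E ι : Type*} [MeasurableSpace E] [StandardBorelSpace E] [Nonempty E]
    [MeasurableSpace ι] (ν μ : Measure E) [IsProbabilityMeasure ν] [IsProbabilityMeasure μ]
    {T : E → ι} (π : Measure (ι × ι)) [IsProbabilityMeasure π]
    (h1 : π.map Prod.fst = ν.map T) (h2 : π.map Prod.snd = μ.map T) :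
    ∃ Θ : Measure ((ι × ι) × (E × E)), IsProbabilityMeasure Θ ∧ Θ.map Prod.fst = π ∧
      Θ.map (fun z => (z.1.1, z.2.1)) = ν.map (fun x => (T x, x)) ∧
      Θ.map (fun z => (z.1.2, z.2.2)) = μ.map (fun x => (T x, x)) := by
  refine ⟨π ⊗ₘ (condDistrib id T ν ∥ₖ condDistrib id T μ), inferInstance,
    Measure.fst_compProd _ _, ?_, ?_⟩
  · change _ = ν.map (fun x => (T x, id x))
    rw [← compProd_map_condDistrib aemeasurable_id, ← h1]
    refine Measure.ext_of_lintegral _ fun g hg => ?_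
    rw [lintegral_map hg (by fun_prop), Measure.lintegral_compProd (by fun_prop),
      Measure.lintegral_compProd hg, lintegral_map hg.lintegral_kernel_prod_right' measurable_fst]
    refine lintegral_congr fun z => ?_
    rw [Kernel.parallelComp_apply, lintegral_prod _ (by fun_prop)]
    simp only [lintegral_const, measure_univ, mul_one]
  · change _ = μ.map (fun x => (T x, id x))
    rw [← compProd_map_condDistrib aemeasurable_id, ← h2]
    refine Measure.ext_of_lintegral _ fun g hg => ?_
    rw [lintegral_map hg (by fun_prop), Measure.lintegral_compProd (by fun_prop),
      Measure.lintegral_compProd hg, lintegral_map hg.lintegral_kernel_prod_right' measurable_snd]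
    refine lintegral_congr fun z => ?_
    rw [Kernel.parallelComp_apply, lintegral_prod _ (by fun_prop)]
    simp only [lintegral_const, measure_univ, mul_one]

/-- The Donsker–Varadhan inequality for relative entropy. -/
lemma integral_le_integral_llr_add_log_integral_exp {α : Type*} [MeasurableSpace α]
    {ν μ : Measure α} [IsProbabilityMeasure ν] [IsProbabilityMeasure μ] (hac : ν ≪ μ)
    (hint : Integrable (llr ν μ) ν) {f : α → ℝ} (hf : Integrable f ν)
    (hexp : Integrable (fun x => Real.exp (f x)) μ) :
    ∫ x, f x ∂ν ≤ ∫ x, llr ν μ x ∂ν + Real.log (∫ x, Real.exp (f x) ∂μ) := by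
  have := isProbabilityMeasure_tilted hexp
  have h0 : 0 ≤ ∫ x, llr ν (μ.tilted f) x ∂ν := by
    rw [← InformationTheory.toReal_klDiv_of_measure_eq
      (hac.trans (absolutelyContinuous_tilted hexp)) (by simp)]
    exact ENNReal.toReal_nonneg
  rw [integral_llr_tilted_right hac hf hexp hint] at h0
  linarith

/-- Potentials with `φ i + ψ j ≤ d(e i, e j)` are separated by a bounded `1`-Lipschitz function. -/
lemma exists_lipschitz_bounded_between {E ι : Type*} [MetricSpace E] [Fintype ι] [Nonempty ι]
    (e : ι → E) (φ ψ : ι → ℝ) (h : ∀ i j, φ i + ψ j ≤ dist (e i) (e j)) :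
    ∃ f : E → ℝ, LipschitzWith 1 f ∧ (∃ B, ∀ x, |f x| ≤ B) ∧
      ∀ i, φ i ≤ f (e i) ∧ f (e i) ≤ -ψ i := by
  set g : E → ℝ := fun x => Finset.univ.inf' Finset.univ_nonempty fun j => dist x (e j) - ψ j
  have hg_le : ∀ x j, g x ≤ dist x (e j) - ψ j := fun x j =>
    Finset.inf'_le (fun j => dist x (e j) - ψ j) (Finset.mem_univ j)
  have hg : LipschitzWith 1 g := LipschitzWith.of_le_add fun x y => by
    obtain ⟨j, -, hj⟩ := Finset.exists_mem_eq_inf' (Finset.univ_nonempty (α := ι))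
      fun j => dist y (e j) - ψ j
    have hgy : g y = dist y (e j) - ψ j := hj
    linarith [hg_le x j, dist_triangle x y (e j)]
  set B : ℝ := ∑ i, (|φ i| + |ψ i|)
  have hB : ∀ i, |φ i| + |ψ i| ≤ B := fun i =>
    Finset.single_le_sum (f := fun i => |φ i| + |ψ i|) (fun i _ => by positivity)
      (Finset.mem_univ i)
  have hB0 : 0 ≤ B := Finset.sum_nonneg fun i _ => by positivity
  refine ⟨fun x => max (min (g x) B) (-B), (hg.min_const B).max_const (-B), ⟨B, fun x => ?_⟩,
    fun i => ⟨?_, ?_⟩⟩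
  · exact abs_le.2 ⟨le_max_right _ _, max_le (min_le_right _ _) (by linarith)⟩
  · refine le_max_of_le_left (le_min ?_ ?_)
    · exact Finset.le_inf' _ _ fun j _ => by linarith [h i j]
    · linarith [hB i, le_abs_self (φ i), abs_nonneg (ψ i)]
  · refine max_le (min_le_of_left_le ?_) ?_
    · simpa using hg_le (e i) i
    · linarith [hB i, le_abs_self (ψ i), abs_nonneg (φ i)]

section Duality

variable {E : Type*} [MeasurableSpace E] [MetricSpace E] [BorelSpace E]

lemma LipschitzWith.integrable_of_bounded {ν : Measure E} [IsFiniteMeasure ν] {f : E → ℝ}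
    (hf : LipschitzWith 1 f) (hb : ∃ B, ∀ x, |f x| ≤ B) : Integrable f ν := by
  obtain ⟨B, hB⟩ := hb
  exact Integrable.of_bound hf.continuous.measurable.aestronglyMeasurable B (.of_forall hB)

lemma dist_approxOn_le [SecondCountableTopology E] (x₀ x : E) (n : ℕ) :
    dist (SimpleFunc.approxOn id measurable_id univ x₀ (mem_univ x₀) n x) x ≤ dist x₀ x := by
  have := SimpleFunc.edist_approxOn_le measurable_id (mem_univ x₀) x n
  simp only [edist_dist, id] at this
  exact (ENNReal.ofReal_le_ofReal_iff dist_nonneg).1 this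

/-- A measure with finite first moment is approximated in mean distance by its images under the
simple functions `SimpleFunc.approxOn id`. -/
lemma tendsto_integral_dist_approxOn [SecondCountableTopology E] (ν : Measure E) (x₀ : E)
    (hν : Integrable (fun x => dist x₀ x) ν) :
    Tendsto
      (fun n => ∫ x, dist (SimpleFunc.approxOn id measurable_id univ x₀ (mem_univ x₀) n x) x ∂ν)
      atTop (𝓝 0) := by
  rw [← integral_zero E ℝ (μ := ν)]
  refine tendsto_integral_of_dominated_convergence (fun x => dist x₀ x) (fun n => ?_) hν
    (fun n => .of_forall fun x => ?_) (.of_forall fun x => ?_)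
  · exact ((SimpleFunc.measurable _).dist measurable_id).aestronglyMeasurable
  · rw [Real.norm_of_nonneg dist_nonneg]
    exact dist_approxOn_le x₀ x n
  · have := SimpleFunc.tendsto_approxOn measurable_id (mem_univ x₀) (x := x) (by simp)
    exact tendsto_iff_dist_tendsto_zero.1 this

/-- Kantorovich–Rubinstein duality (existence of almost optimal couplings). -/
lemma exists_coupling_integral_dist_le [PolishSpace E] (ν μ : Measure E)
    [IsProbabilityMeasure ν] [IsProbabilityMeasure μ] (x₀ : E)
    (hν : Integrable (fun x => dist x₀ x) ν) (hμ : Integrable (fun x => dist x₀ x) μ) (M : ℝ)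
    (hM : ∀ f : E → ℝ, LipschitzWith 1 f → (∃ B, ∀ x, |f x| ≤ B) →
      ∫ x, f x ∂ν - ∫ x, f x ∂μ ≤ M) {ε : ℝ} (hε : 0 < ε) :
    ∃ π : Measure (E × E), IsProbabilityMeasure π ∧ π.map Prod.fst = ν ∧ π.map Prod.snd = μ ∧
      ∫ q, dist q.1 q.2 ∂π ≤ M + ε := by
  have : Nonempty E := ⟨x₀⟩
  obtain ⟨n, hnν, hnμ⟩ := (((tendsto_integral_dist_approxOn ν x₀ hν).eventually_lt_const
    (show (0 : ℝ) < ε / 4 by positivity)).and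
    ((tendsto_integral_dist_approxOn μ x₀ hμ).eventually_lt_const
    (show (0 : ℝ) < ε / 4 by positivity))).exists
  set T := SimpleFunc.approxOn id measurable_id univ x₀ (mem_univ x₀) n
  have hTint : ∀ (ρ : Measure E) [IsProbabilityMeasure ρ], Integrable (fun x => dist x₀ x) ρ →
      Integrable (fun x => dist (T x) x) ρ := by
    intro ρ _ hρ
    refine hρ.mono' (T.measurable.dist measurable_id).aestronglyMeasurable (.of_forall fun x => ?_)
    rw [Real.norm_of_nonneg dist_nonneg]
    exact dist_approxOn_le x₀ x n
  let T' : E → T.range := fun x => ⟨T x, SimpleFunc.mem_range_self T x⟩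
  have hT' : Measurable T' := T.measurable.subtype_mk
  have : Nonempty T.range := ⟨T' x₀⟩
  have := Measure.isProbabilityMeasure_map (μ := ν) hT'.aemeasurable
  have := Measure.isProbabilityMeasure_map (μ := μ) hT'.aemeasurable
  have hmeas : ∀ g : T.range → ℝ, Measurable g := fun g => measurable_of_finite g
  obtain ⟨π, hπ, hπ1, hπ2, hπM⟩ := exists_coupling_integral_le_of_finite (ν.map T') (μ.map T')
    (fun i j => dist (i : E) j) (M + ε / 2) fun φ ψ hφψ => by
      obtain ⟨f, hf, hfb, hfs⟩ := exists_lipschitz_bounded_between (fun i : T.range => (i : E))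
        φ ψ hφψ
      have hfT : ∀ x, |f (T x) - f x| ≤ dist (T x) x := fun x => by
        simpa [Real.dist_eq] using hf.dist_le_mul (T x) x
      rw [integral_map hT'.aemeasurable (hmeas _).aestronglyMeasurable,
        integral_map hT'.aemeasurable (hmeas _).aestronglyMeasurable]
      have e1 : ∫ x, φ (T' x) ∂ν ≤ ∫ x, (f x + dist (T x) x) ∂ν := by
        refine integral_mono (Integrable.of_finite.comp_measurable hT')
          ((hf.integrable_of_bounded hfb).add (hTint ν hν)) fun x => ?_
        linarith [(hfs (T' x)).1, le_abs_self (f (T x) - f x), hfT x]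
      have e2 : ∫ x, ψ (T' x) ∂μ ≤ ∫ x, (dist (T x) x - f x) ∂μ := by
        refine integral_mono (Integrable.of_finite.comp_measurable hT')
          ((hTint μ hμ).sub (hf.integrable_of_bounded hfb)) fun x => ?_
        linarith [(hfs (T' x)).2, neg_abs_le (f (T x) - f x), hfT x]
      rw [integral_add (hf.integrable_of_bounded hfb) (hTint ν hν)] at e1
      rw [integral_sub (hTint μ hμ) (hf.integrable_of_bounded hfb)] at e2
      linarith [hM f hf hfb]
  obtain ⟨Θ, hΘ, hΘ0, hΘ1, hΘ2⟩ := exists_lift_coupling ν μ π hπ1 hπ2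
  have hd : Measurable fun z : T.range × E => dist (z.1 : E) z.2 := by fun_prop
  have hTT : Measurable fun x => (T' x, x) := hT'.prodMk measurable_id
  have i0 : Integrable (fun z : (T.range × T.range) × (E × E) => dist (z.1.1 : E) z.1.2) Θ :=
    (Integrable.of_finite (μ := Θ.map Prod.fst)
      (f := fun z : T.range × T.range => dist (z.1 : E) z.2)).comp_measurable measurable_fst
  have i1 : Integrable (fun z : (T.range × T.range) × (E × E) => dist (z.1.1 : E) z.2.1) Θ := by
    refine Integrable.comp_measurable (g := fun z : T.range × E => dist (z.1 : E) z.2)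
      (f := fun z : (T.range × T.range) × (E × E) => (z.1.1, z.2.1)) ?_ (by fun_prop)
    rw [hΘ1, integrable_map_measure hd.aestronglyMeasurable hTT.aemeasurable]
    exact hTint ν hν
  have i2 : Integrable (fun z : (T.range × T.range) × (E × E) => dist (z.1.2 : E) z.2.2) Θ := by
    refine Integrable.comp_measurable (g := fun z : T.range × E => dist (z.1 : E) z.2)
      (f := fun z : (T.range × T.range) × (E × E) => (z.1.2, z.2.2)) ?_ (by fun_prop)
    rw [hΘ2, integrable_map_measure hd.aestronglyMeasurable hTT.aemeasurable]
    exact hTint μ hμ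
  have v0 : ∫ z, dist (z.1.1 : E) z.1.2 ∂Θ ≤ M + ε / 2 := by
    rw [← hΘ0, integral_map (by fun_prop) (by fun_prop)] at hπM
    exact hπM
  have v1 : ∫ z, dist (z.1.1 : E) z.2.1 ∂Θ = ∫ x, dist (T x) x ∂ν := by
    have := integral_map (μ := Θ) (f := fun z : T.range × E => dist (z.1 : E) z.2)
      (φ := fun z : (T.range × T.range) × (E × E) => (z.1.1, z.2.1)) (by fun_prop)
      hd.aestronglyMeasurable
    rw [← this, hΘ1, integral_map hTT.aemeasurable hd.aestronglyMeasurable]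
  have v2 : ∫ z, dist (z.1.2 : E) z.2.2 ∂Θ = ∫ x, dist (T x) x ∂μ := by
    have := integral_map (μ := Θ) (f := fun z : T.range × E => dist (z.1 : E) z.2)
      (φ := fun z : (T.range × T.range) × (E × E) => (z.1.2, z.2.2)) (by fun_prop)
      hd.aestronglyMeasurable
    rw [← this, hΘ2, integral_map hTT.aemeasurable hd.aestronglyMeasurable]
  refine ⟨Θ.map Prod.snd, Measure.isProbabilityMeasure_map measurable_snd.aemeasurable, ?_, ?_, ?_⟩
  · have := congrArg (Measure.map Prod.snd) hΘ1
    rw [Measure.map_map measurable_snd (by fun_prop), Measure.map_map measurable_snd hTT] at this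
    rw [Measure.map_map measurable_fst measurable_snd]
    exact this.trans Measure.map_id
  · have := congrArg (Measure.map Prod.snd) hΘ2
    rw [Measure.map_map measurable_snd (by fun_prop), Measure.map_map measurable_snd hTT] at this
    rw [Measure.map_map measurable_snd measurable_snd]
    exact this.trans Measure.map_id
  · rw [integral_map (by fun_prop) (by fun_prop)]
    calc ∫ z, dist z.2.1 z.2.2 ∂Θ
        ≤ ∫ z, (dist (z.1.1 : E) z.1.2 + dist (z.1.1 : E) z.2.1 + dist (z.1.2 : E) z.2.2) ∂Θ := by
          refine integral_mono_of_nonneg (.of_forall fun _ => dist_nonneg) ((i0.add i1).add i2)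
            (.of_forall fun z => ?_)
          linarith [dist_triangle4 z.2.1 (z.1.1 : E) z.1.2 z.2.2, dist_comm z.2.1 (z.1.1 : E)]
      _ ≤ M + ε := by
          rw [integral_add (by exact i0.add i1) i2, integral_add i0 i1, v1, v2]
          linarith

end Duality

/-- The transport inequality for Lipschitz test functions, from Gaussian exponential moments. -/
lemma integral_sub_integral_le_sqrt {α : Type*} [MeasurableSpace α] {ν μ : Measure α}
    [IsProbabilityMeasure ν] [IsProbabilityMeasure μ] (hac : ν ≪ μ)
    (hint : Integrable (llr ν μ) ν) {K : ℝ} (hK : 0 < K) {f : α → ℝ} (hf : Measurable f)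
    (hb : ∃ B, ∀ x, |f x| ≤ B)
    (hGauss : ∀ lam : ℝ, 0 < lam →
      ∫ x, Real.exp (lam * (f x - ∫ y, f y ∂μ)) ∂μ ≤ Real.exp (K * lam ^ 2 / 2)) :
    ∫ x, f x ∂ν - ∫ x, f x ∂μ ≤ √(2 * K * ∫ x, llr ν μ x ∂ν) := by
  obtain ⟨B, hB⟩ := hb
  set t := ∫ x, f x ∂ν - ∫ x, f x ∂μ
  rcases le_or_gt t 0 with ht | ht
  · exact ht.trans (Real.sqrt_nonneg _)
  have hfν : Integrable f ν := .of_bound hf.aestronglyMeasurable B (.of_forall hB)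
  set m := ∫ y, f y ∂μ
  have hlam : 0 < t / K := by positivity
  have hexp : Integrable (fun x => Real.exp (t / K * (f x - m))) μ := by
    refine .of_bound (by fun_prop) (Real.exp (t / K * (B - m))) (.of_forall fun x => ?_)
    rw [Real.norm_of_nonneg (Real.exp_pos _).le]
    gcongr
    exact (le_abs_self _).trans (hB x)
  have hdv := integral_le_integral_llr_add_log_integral_exp hac hint
    ((hfν.sub (integrable_const m)).const_mul (t / K)) hexp
  have hlog : Real.log (∫ x, Real.exp (t / K * (f x - m)) ∂μ) ≤ K * (t / K) ^ 2 / 2 := by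
    rw [Real.log_le_iff_le_exp (integral_exp_pos hexp)]
    exact hGauss _ hlam
  have hl : ∫ x, t / K * (f x - m) ∂ν = t / K * t := by
    rw [integral_const_mul, integral_sub hfν (integrable_const m)]
    simp [t, m]
  simp only [Pi.sub_apply] at hdv
  rw [hl] at hdv
  refine Real.le_sqrt_of_sq_le ?_
  have h1 : t / K * t - K * (t / K) ^ 2 / 2 = t ^ 2 / (2 * K) := by field_simp; ring
  have h2 : t ^ 2 / (2 * K) ≤ ∫ x, llr ν μ x ∂ν := by linarith
  rw [div_le_iff₀ (by positivity)] at h2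
  linarith

/-- Bobkov–Götze, converse direction: if every bounded `1`-Lipschitz `f : E → ℝ` satisfies
`E^μ e^{λ(f - μ(f))} ≤ e^{Kλ²/2}` for all `λ > 0`, then `μ` satisfies the `T₁`
transportation inequality `W₁(ν,μ) ≤ √(2K h(ν|μ))` for all probability measures `ν`. -/
theorem bobkov_goetze_gaussian_bound_implies_T1
    {E : Type*} [MeasurableSpace E] [MetricSpace E] [BorelSpace E]
    [PolishSpace E]
    (μ : Measure E) [IsProbabilityMeasure μ] (K : ℝ) (hK : 0 < K)
    (hGauss : ∀ f : E → ℝ, LipschitzWith 1 f → (∃ M, ∀ x, |f x| ≤ M) → ∀ lam : ℝ, 0 < lam →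
      ∫ x, Real.exp (lam * (f x - ∫ y, f y ∂μ)) ∂μ ≤ Real.exp (K * lam ^ 2 / 2)) :
    ∀ ν : Measure E, IsProbabilityMeasure ν →
      ENNReal.ofReal (wassersteinOne ν μ) ≤
        (2 * ENNReal.ofReal K * relEnt ν μ) ^ (1 / 2 : ℝ) := by
  intro ν hν
  by_cases hent : ν ≪ μ ∧ Integrable (llr ν μ) ν
  swap
  · rw [relEnt, if_neg hent, ENNReal.mul_top (by simp [hK]), ENNReal.top_rpow_of_pos (by norm_num)]
    exact le_top
  obtain ⟨hac, hint⟩ := hent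
  have hbdd : BddBelow {r : ℝ | ∃ π : Measure (E × E), IsProbabilityMeasure π ∧
      π.map Prod.fst = ν ∧ π.map Prod.snd = μ ∧ r = ∫ q, dist q.1 q.2 ∂π} :=
    ⟨0, by rintro _ ⟨π, -, -, -, rfl⟩; exact integral_nonneg fun _ => dist_nonneg⟩
  have hW : wassersteinOne ν μ ≤ √(2 * K * ∫ x, llr ν μ x ∂ν) := by
    by_cases hprod : Integrable (fun q : E × E => dist q.1 q.2) (ν.prod μ)
    · obtain ⟨y, hy⟩ := hprod.prod_left_ae.exists
      obtain ⟨x, hx⟩ := hprod.prod_right_ae.exists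
      have hy' : Integrable (fun z => dist x z) ν := by
        refine ((integrable_const (dist x y)).add hy).mono'
          (measurable_const.dist measurable_id).aestronglyMeasurable (.of_forall fun z => ?_)
        rw [Real.norm_of_nonneg dist_nonneg]
        exact dist_triangle_right x z y
      refine le_of_forall_pos_le_add fun ε hε => ?_
      obtain ⟨π, hπ, h1, h2, h3⟩ := exists_coupling_integral_dist_le ν μ x hy' hx _
        (fun f hf hfb => integral_sub_integral_le_sqrt hac hint hK hf.continuous.measurable hfb
          (hGauss f hf hfb)) hε
      exact (csInf_le hbdd ⟨π, hπ, h1, h2, rfl⟩).trans h3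
    · refine le_trans (csInf_le hbdd ⟨ν.prod μ, inferInstance, by simp, by simp, rfl⟩) ?_
      -- the cost of the product coupling is not integrable, so its Bochner integral is `0`
      rw [integral_undef hprod]
      exact Real.sqrt_nonneg _
  rw [relEnt, if_pos ⟨hac, hint⟩, ← ENNReal.ofReal_ofNat 2, ← ENNReal.ofReal_mul (by norm_num),
    ← ENNReal.ofReal_mul (by positivity)]
  refine (ENNReal.ofReal_le_ofReal hW).trans ?_
  rw [Real.sqrt_eq_rpow]
  refine (ENNReal.ofReal_rpow_of_nonneg ?_ (by norm_num)).ge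
  rw [← InformationTheory.toReal_klDiv_of_measure_eq hac (by simp)]
  positivity
end

section
/- For a probability measure μ_h(dx) = e^{h·x} m(dx) / Z(h) on the unit sphere S^p ⊂ ℝ^{p+1}, where m is the normalized uniform measure, the covariance μ_h(e·x; e·x) of the linear functional x ↦ e·x (|e|=1) is at most 1/(p+1). -/
open MeasureTheory ProbabilityTheory
open scoped RealInnerProductSpace

section Riccati

variable {p : ℕ} {M₀ M₁ M₂ M₃ : ℝ → ℝ}

lemma deriv_moment_relation (h₀ : ∀ t, HasDerivAt M₀ (M₁ t) t)
    (h₁ : ∀ t, HasDerivAt M₁ (M₂ t) t) (h₂ : ∀ t, HasDerivAt M₂ (M₃ t) t)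
    (hrel : ∀ t, t * (M₀ t - M₂ t) = p * M₁ t) (t : ℝ) :
    M₀ t - M₂ t + t * (M₁ t - M₃ t) = p * M₂ t := by
  have hl := (hasDerivAt_id t).mul ((h₀ t).sub (h₂ t))
  have hr := (h₁ t).const_mul (p : ℝ)
  have heq : (id * (M₀ - M₂) : ℝ → ℝ) = fun t => (p : ℝ) * M₁ t := funext hrel
  rw [heq] at hl
  simpa using hl.unique hr

lemma first_moment_nonneg (hp : 1 ≤ p) (hle : ∀ t, M₂ t ≤ M₀ t)
    (hrel : ∀ t, t * (M₀ t - M₂ t) = p * M₁ t) {t : ℝ} (ht : 0 ≤ t) : 0 ≤ M₁ t := by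
  have h : 0 ≤ (p : ℝ) * M₁ t := hrel t ▸ mul_nonneg ht (sub_nonneg.2 (hle t))
  exact nonneg_of_mul_nonneg_right h (by exact_mod_cast hp)

lemma le_second_moment (hp : 1 ≤ p) (h₀ : ∀ t, HasDerivAt M₀ (M₁ t) t)
    (h₁ : ∀ t, HasDerivAt M₁ (M₂ t) t) (h₂ : ∀ t, HasDerivAt M₂ (M₃ t) t)
    (hle : ∀ t, M₂ t ≤ M₀ t)
    (hrel : ∀ t, t * (M₀ t - M₂ t) = p * M₁ t) {t : ℝ} (ht : 0 ≤ t) :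
    M₀ t ≤ (p + 1) * M₂ t := by
  rcases ht.eq_or_lt with rfl | ht
  · linarith [deriv_moment_relation h₀ h₁ h₂ hrel 0]
  have hd (s : ℝ) : HasDerivAt (fun s => s ^ (p + 1) * ((p + 1) * M₂ s - M₀ s))
      (s ^ p * (p * (s * M₁ s))) s := by
    refine ((hasDerivAt_pow (p + 1) s).mul
      (((h₂ s).const_mul (p + 1 : ℝ)).sub (h₀ s))).congr_deriv ?_
    have := deriv_moment_relation h₀ h₁ h₂ hrel s
    simp only [Nat.add_sub_cancel, Nat.cast_add, Nat.cast_one, Pi.sub_apply]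
    linear_combination (-s ^ p * (p + 1)) * this
  have hmono : MonotoneOn (fun s => s ^ (p + 1) * ((p + 1) * M₂ s - M₀ s)) (Set.Ici 0) := by
    refine monotoneOn_of_deriv_nonneg (convex_Ici 0)
      (fun s _ => (hd s).continuousAt.continuousWithinAt)
      (fun s _ => (hd s).differentiableAt.differentiableWithinAt) fun s hs => ?_
    rw [interior_Ici, Set.mem_Ioi] at hs
    have := first_moment_nonneg hp hle hrel hs.le
    rw [(hd s).deriv]
    positivity
  have h := hmono Set.self_mem_Ici ht.le ht.le
  simp only [ne_eq, Nat.add_eq_zero_iff, one_ne_zero, and_false, not_false_eq_true, zero_pow,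
    zero_mul] at h
  linarith [nonneg_of_mul_nonneg_right h (by positivity)]

lemma moment_variance_le (hp : 1 ≤ p) (hpos : ∀ t, 0 < M₀ t)
    (h₀ : ∀ t, HasDerivAt M₀ (M₁ t) t)
    (h₁ : ∀ t, HasDerivAt M₁ (M₂ t) t) (h₂ : ∀ t, HasDerivAt M₂ (M₃ t) t)
    (hle : ∀ t, M₂ t ≤ M₀ t) (hvar : ∀ t, (M₁ t / M₀ t) ^ 2 ≤ M₂ t / M₀ t)
    (hrel : ∀ t, t * (M₀ t - M₂ t) = p * M₁ t) {t : ℝ} (ht : 0 ≤ t) :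
    M₂ t / M₀ t - (M₁ t / M₀ t) ^ 2 ≤ 1 / (p + 1) := by
  rcases ht.eq_or_lt with rfl | ht
  · have h := deriv_moment_relation h₀ h₁ h₂ hrel 0
    have : M₂ 0 / M₀ 0 ≤ 1 / (p + 1) := by
      rw [div_le_div_iff₀ (hpos 0) (by positivity)]
      linarith
    linarith [sq_nonneg (M₁ 0 / M₀ 0)]
  obtain ⟨q, rfl⟩ : ∃ q, p = q + 1 := ⟨p - 1, by lia⟩
  push_cast at hrel ⊢
  have hd (s : ℝ) : HasDerivAt
      (fun s => s ^ (q + 1) * (M₂ s / M₀ s - (M₁ s / M₀ s) ^ 2 - 1 / (q + 1 + 1 : ℝ)))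
      (s ^ q * (1 / (q + 1 + 1) - M₂ s / M₀ s
        - 2 * (s * M₁ s / M₀ s) * (M₂ s / M₀ s - (M₁ s / M₀ s) ^ 2))) s := by
    have hne := (hpos s).ne'
    refine ((hasDerivAt_pow (q + 1) s).mul ((((h₂ s).div (h₀ s) hne).sub
      (((h₁ s).div (h₀ s) hne).pow 2)).sub_const (1 / (q + 1 + 1 : ℝ)))).congr_deriv ?_
    have hr := hrel s
    have hr' := deriv_moment_relation h₀ h₁ h₂ (p := q + 1) (by exact_mod_cast hrel) s
    have hq : (q + 1 + 1 : ℝ) ≠ 0 := by positivity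
    simp only [Nat.cast_add, Nat.cast_one, Pi.sub_apply, Pi.div_apply,
      Pi.pow_apply, Nat.cast_ofNat, pow_one, pow_succ s q, Nat.add_one_sub_one] at hr' ⊢
    rw [← sub_eq_zero]
    trans (s ^ q * M₁ s / M₀ s ^ 2) * (s * (M₀ s - M₂ s) - (q + 1) * M₁ s) -
      (s ^ q / M₀ s) * (M₀ s - M₂ s + s * (M₁ s - M₃ s) - (q + 1) * M₂ s)
    · field_simp
      ring
    · rw [hr, hr', sub_self, sub_self, mul_zero, mul_zero, sub_zero]
  have hanti : AntitoneOn
      (fun s => s ^ (q + 1) * (M₂ s / M₀ s - (M₁ s / M₀ s) ^ 2 - 1 / (q + 1 + 1 : ℝ)))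
      (Set.Ici 0) := by
    refine antitoneOn_of_deriv_nonpos (convex_Ici 0)
      (fun s _ => (hd s).continuousAt.continuousWithinAt)
      (fun s _ => (hd s).differentiableAt.differentiableWithinAt) fun s hs => ?_
    rw [interior_Ici, Set.mem_Ioi] at hs
    have hM := first_moment_nonneg hp hle (by exact_mod_cast hrel) hs.le
    have hlow := le_second_moment hp h₀ h₁ h₂ hle (by exact_mod_cast hrel) hs.le
    push_cast at hlow
    have hs' := hpos s
    have hlow' : 1 / (q + 1 + 1 : ℝ) ≤ M₂ s / M₀ s := by
      rw [div_le_div_iff₀ (by positivity) hs']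
      linarith
    rw [(hd s).deriv]
    have := mul_nonneg (show 0 ≤ 2 * (s * M₁ s / M₀ s) by positivity) (sub_nonneg.2 (hvar s))
    exact mul_nonpos_of_nonneg_of_nonpos (by positivity) (by linarith)
  have h := hanti Set.self_mem_Ici ht.le ht.le
  simp only [ne_eq, Nat.add_eq_zero_iff, one_ne_zero, and_false, not_false_eq_true, zero_pow,
    zero_mul] at h
  linarith [nonpos_of_mul_nonpos_right h (by positivity)]

end Riccati

section Sphere

variable {E : Type*} [NormedAddCommGroup E] [InnerProductSpace ℝ E] [MeasurableSpace E]
  [BorelSpace E] {m : Measure E}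

lemma integral_comp_isometry
    (hinv : ∀ O : E ≃ₗᵢ[ℝ] E, m.map O = m) (O : E ≃ₗᵢ[ℝ] E) (f : E → ℝ) :
    ∫ x, f (O x) ∂m = ∫ x, f x ∂m := by
  conv_rhs => rw [← hinv O]
  exact (integral_map_equiv O.toHomeomorph.toMeasurableEquiv f).symm

/-- Integrals of functions of `⟪a, x⟫` depend on `a` only through its norm. -/
lemma integral_comp_inner_eq_of_norm_eq (hinv : ∀ O : E ≃ₗᵢ[ℝ] E, m.map O = m) {a b : E}
    (hab : ‖a‖ = ‖b‖) (f : ℝ → ℝ) : ∫ x, f ⟪a, x⟫ ∂m = ∫ x, f ⟪b, x⟫ ∂m := by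
  rw [← integral_comp_isometry hinv (ℝ ∙ (a - b))ᗮ.reflection fun x => f ⟪b, x⟫]
  congr! 3 with x
  rw [← LinearIsometryEquiv.inner_map_map (ℝ ∙ (a - b))ᗮ.reflection a, Submodule.reflection_sub hab]

lemma integral_inner_mul_comp_inner_eq_zero (hinv : ∀ O : E ≃ₗᵢ[ℝ] E, m.map O = m) {a v : E}
    (hav : ⟪v, a⟫ = 0) (f : ℝ → ℝ) : ∫ x, ⟪v, x⟫ * f ⟪a, x⟫ ∂m = 0 := by
  have h := integral_comp_isometry hinv (ℝ ∙ v)ᗮ.reflection fun x => ⟪v, x⟫ * f ⟪a, x⟫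
  have hv (x : E) : ⟪v, (ℝ ∙ v)ᗮ.reflection x⟫ = -⟪v, x⟫ := by
    rw [← LinearIsometryEquiv.inner_map_map (ℝ ∙ v)ᗮ.reflection, Submodule.reflection_reflection,
      Submodule.reflection_orthogonalComplement_singleton_eq_neg, inner_neg_left]
  have ha (x : E) : ⟪a, (ℝ ∙ v)ᗮ.reflection x⟫ = ⟪a, x⟫ := by
    rw [← LinearIsometryEquiv.inner_map_map (ℝ ∙ v)ᗮ.reflection, Submodule.reflection_reflection,
      Submodule.reflection_mem_subspace_eq_self
        (Submodule.mem_orthogonal_singleton_iff_inner_right.2 hav)]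
  simp only [hv, ha, neg_mul, integral_neg] at h
  linarith

variable [FiniteDimensional ℝ E] [IsProbabilityMeasure m]

/-- A continuous function is bounded, hence integrable, on the unit sphere. -/
lemma Continuous.integrable_of_ae_norm_eq_one (hs : ∀ᵐ x ∂m, ‖x‖ = 1) {f : E → ℝ}
    (hf : Continuous f) : Integrable f m := by
  obtain ⟨C, hC⟩ := (isCompact_sphere (0 : E) 1).exists_bound_of_continuousOn hf.continuousOn
  refine .of_bound hf.aestronglyMeasurable C ?_
  filter_upwards [hs] with x hx
  exact hC x (by simpa using hx)

lemma hasDerivAt_integral_mul_exp (hs : ∀ᵐ x ∂m, ‖x‖ = 1) {f : E → ℝ} (hf : Continuous f)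
    (v : E) (t : ℝ) :
    HasDerivAt (fun t => ∫ x, f x * Real.exp (t * ⟪v, x⟫) ∂m)
      (∫ x, f x * ⟪v, x⟫ * Real.exp (t * ⟪v, x⟫) ∂m) t := by
  refine (hasDerivAt_integral_of_dominated_loc_of_deriv_le (Metric.ball_mem_nhds t one_pos)
    (F' := fun t x => f x * ⟪v, x⟫ * Real.exp (t * ⟪v, x⟫))
    (bound := fun x => |f x * ⟪v, x⟫| * Real.exp ((|t| + 1) * |⟪v, x⟫|))
    (.of_forall fun s => ?_) ?_ ?_ (.of_forall fun x s hx => ?_) ?_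
    (.of_forall fun x s _ => ?_)).2
  · exact Continuous.aestronglyMeasurable (by fun_prop)
  · exact Continuous.integrable_of_ae_norm_eq_one hs (by fun_prop)
  · exact Continuous.aestronglyMeasurable (by fun_prop)
  · rw [norm_mul, Real.norm_eq_abs, Real.norm_eq_abs, Real.abs_exp]
    refine mul_le_mul_of_nonneg_left (Real.exp_le_exp.2 ((le_abs_self _).trans ?_)) (abs_nonneg _)
    rw [abs_mul]
    gcongr
    rw [Metric.mem_ball, Real.dist_eq] at hx
    linarith [abs_sub_abs_le_abs_sub s t]
  · exact Continuous.integrable_of_ae_norm_eq_one hs (by fun_prop)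
  · exact ((((hasDerivAt_id s).mul_const ⟪v, x⟫).exp).const_mul (f x)).congr_deriv
      (by simp; ring)

/-- The unnormalized moments of `⟪u, x⟫` under the exponentially tilted measure. -/
noncomputable def expMoment (m : Measure E) (u : E) (k : ℕ) (t : ℝ) : ℝ :=
  ∫ x, ⟪u, x⟫ ^ k * Real.exp (t * ⟪u, x⟫) ∂m

lemma hasDerivAt_expMoment (hs : ∀ᵐ x ∂m, ‖x‖ = 1) (u : E) (k : ℕ) (t : ℝ) :
    HasDerivAt (expMoment m u k) (expMoment m u (k + 1) t) t := by
  simp only [expMoment, pow_succ]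
  exact hasDerivAt_integral_mul_exp hs (f := fun x => ⟪u, x⟫ ^ k) (by fun_prop) u t

lemma integral_inner_sq_mul_exp_of_orthogonal (hs : ∀ᵐ x ∂m, ‖x‖ = 1)
    (hinv : ∀ O : E ≃ₗᵢ[ℝ] E, m.map O = m) {u v : E} (hu : ‖u‖ = 1) (huv : ⟪u, v⟫ = 0)
    {t : ℝ} (ht : t ≠ 0) :
    t * ∫ x, ⟪v, x⟫ ^ 2 * Real.exp (t * ⟪u, x⟫) ∂m = ‖v‖ ^ 2 * expMoment m u 1 t := by
  set r : ℝ → ℝ := fun s => √(t ^ 2 + s ^ 2 * ‖v‖ ^ 2) * (t / |t|) with hr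
  have habs : |t| ≠ 0 := abs_ne_zero.2 ht
  have hr2 (s : ℝ) : r s ^ 2 = t ^ 2 + s ^ 2 * ‖v‖ ^ 2 := by
    rw [hr, mul_pow, Real.sq_sqrt (by positivity), div_pow, sq_abs, div_self (pow_ne_zero 2 ht),
      mul_one]
  have hr0 : r 0 = t := by
    simp only [hr, ne_eq, OfNat.ofNat_ne_zero, not_false_eq_true, zero_pow, zero_mul, add_zero,
      Real.sqrt_sq_eq_abs]
    field_simp
  have hrne (s : ℝ) : r s ≠ 0 := by
    intro h
    have := hr2 s
    rw [h] at this
    have : 0 < t ^ 2 := by positivity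
    nlinarith [sq_nonneg (s * ‖v‖)]
  have key (s : ℝ) : ∫ x, ⟪v, x⟫ * Real.exp (t * ⟪u, x⟫) * Real.exp (s * ⟪v, x⟫) ∂m
      = s * (‖v‖ ^ 2 * (expMoment m u 1 (r s) / r s)) := by
    set a : E := t • u + s • v with ha
    have hna : ‖a‖ ^ 2 = r s ^ 2 := by
      rw [hr2, ha, norm_add_sq_real, inner_smul_left, inner_smul_right, huv, norm_smul, norm_smul,
        hu, mul_pow, Real.norm_eq_abs, Real.norm_eq_abs, sq_abs, mul_pow, sq_abs]
      ring
    have hva : ⟪v, a⟫ = s * ‖v‖ ^ 2 := by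
      rw [ha, inner_add_right, inner_smul_right, inner_smul_right, real_inner_comm, huv,
        real_inner_self_eq_norm_sq]
      ring
    have hperp : ⟪v - (⟪v, a⟫ / r s ^ 2) • a, a⟫ = 0 := by
      rw [inner_sub_left, inner_smul_left, real_inner_self_eq_norm_sq, hna]
      simp [hrne s]
    have h0 := integral_inner_mul_comp_inner_eq_zero hinv hperp Real.exp
    have hrad : ∫ x, ⟪a, x⟫ * Real.exp ⟪a, x⟫ ∂m = r s * expMoment m u 1 (r s) := by
      rw [integral_comp_inner_eq_of_norm_eq hinv (b := r s • u) ?_ fun y => y * Real.exp y,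
        expMoment, ← integral_const_mul]
      · congr! 2 with x
        rw [inner_smul_left]
        simp
        ring
      · rw [norm_smul, hu, mul_one, Real.norm_eq_abs, ← abs_norm a]
        exact sq_eq_sq_iff_abs_eq_abs _ _ |>.1 hna
    have hsplit : ∫ x, ⟪v, x⟫ * Real.exp ⟪a, x⟫ ∂m
        = (⟪v, a⟫ / r s ^ 2) * ∫ x, ⟪a, x⟫ * Real.exp ⟪a, x⟫ ∂m := by
      rw [← integral_const_mul, ← sub_eq_zero, ← integral_sub, ← h0]
      · congr! 2 with x
        rw [inner_sub_left, inner_smul_left]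
        simp
        ring
      · exact Continuous.integrable_of_ae_norm_eq_one hs (by fun_prop)
      · exact Continuous.integrable_of_ae_norm_eq_one hs (by fun_prop)
    have hexp (x : E) : ⟪v, x⟫ * Real.exp (t * ⟪u, x⟫) * Real.exp (s * ⟪v, x⟫)
        = ⟪v, x⟫ * Real.exp ⟪a, x⟫ := by
      rw [mul_assoc, ← Real.exp_add, ha, inner_add_left, inner_smul_left, inner_smul_left]
      simp
    simp only [hexp]
    rw [hsplit, hrad, hva]
    field_simp [hrne s]
  have hd := hasDerivAt_integral_mul_exp hs
    (f := fun x => ⟪v, x⟫ * Real.exp (t * ⟪u, x⟫)) (by fun_prop) v 0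
  have hcont : ContinuousAt (fun s => ‖v‖ ^ 2 * (expMoment m u 1 (r s) / r s)) 0 := by
    have hrc : Continuous r := by fun_prop
    have hMc : Continuous (expMoment m u 1) :=
      continuous_iff_continuousAt.2 fun t => (hasDerivAt_expMoment hs u 1 t).continuousAt
    exact (continuous_const.mul ((hMc.comp hrc).div hrc hrne)).continuousAt
  simp only [key] at hd
  have hd' : HasDerivAt (fun s => s * (‖v‖ ^ 2 * (expMoment m u 1 (r s) / r s)))
      (‖v‖ ^ 2 * (expMoment m u 1 (r 0) / r 0)) 0 := by
    rw [hasDerivAt_iff_tendsto_slope]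
    refine (hcont.tendsto.mono_left nhdsWithin_le_nhds).congr' ?_
    filter_upwards [self_mem_nhdsWithin] with s hs
    rw [slope_def_field, zero_mul, sub_zero, sub_zero, mul_div_cancel_left₀ _ hs]
  have h := hd.unique hd'
  simp only [zero_mul, Real.exp_zero, mul_one, hr0] at h
  have hsq (x : E) : ⟪v, x⟫ ^ 2 * Real.exp (t * ⟪u, x⟫)
      = ⟪v, x⟫ * Real.exp (t * ⟪u, x⟫) * ⟪v, x⟫ := by ring
  simp only [hsq]
  rw [h]
  field_simp

/-- The second moments of a linear functional, split along `u` and its orthogonal complement. -/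
lemma integral_inner_sq_mul_exp (hs : ∀ᵐ x ∂m, ‖x‖ = 1)
    (hinv : ∀ O : E ≃ₗᵢ[ℝ] E, m.map O = m) {u : E} (hu : ‖u‖ = 1) (e : E)
    (t : ℝ) :
    t * ∫ x, ⟪e, x⟫ ^ 2 * Real.exp (t * ⟪u, x⟫) ∂m =
      ⟪e, u⟫ ^ 2 * (t * expMoment m u 2 t) + (‖e‖ ^ 2 - ⟪e, u⟫ ^ 2) * expMoment m u 1 t := by
  set v : E := e - ⟪e, u⟫ • u with hv
  have huv : ⟪u, v⟫ = 0 := by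
    rw [hv, inner_sub_right, inner_smul_right, real_inner_self_eq_norm_sq, hu, real_inner_comm]
    ring
  have hvu : ⟪v, u⟫ = 0 := by rw [real_inner_comm, huv]
  have hev : e = ⟪e, u⟫ • u + v := by rw [hv]; abel
  have hnv : ‖v‖ ^ 2 = ‖e‖ ^ 2 - ⟪e, u⟫ ^ 2 := by
    rw [hv, norm_sub_sq_real, inner_smul_right, norm_smul, hu, mul_one, Real.norm_eq_abs, sq_abs]
    ring
  rcases eq_or_ne t 0 with rfl | ht
  · have := integral_inner_mul_comp_inner_eq_zero hinv (inner_zero_right u) fun _ => 1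
    simp only [mul_one] at this
    simp [expMoment, this]
  have hcross := integral_inner_mul_comp_inner_eq_zero hinv hvu fun y => y * Real.exp (t * y)
  rw [← hnv, ← integral_inner_sq_mul_exp_of_orthogonal hs hinv hu huv ht]
  have hexp (x : E) : ⟪e, x⟫ ^ 2 * Real.exp (t * ⟪u, x⟫) =
      ⟪e, u⟫ ^ 2 * (⟪u, x⟫ ^ 2 * Real.exp (t * ⟪u, x⟫)) +
      (2 * ⟪e, u⟫) * (⟪v, x⟫ * (⟪u, x⟫ * Real.exp (t * ⟪u, x⟫))) +
      ⟪v, x⟫ ^ 2 * Real.exp (t * ⟪u, x⟫) := by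
    have : ⟪e, x⟫ = ⟪e, u⟫ * ⟪u, x⟫ + ⟪v, x⟫ := by
      conv_lhs => rw [hev, inner_add_left, inner_smul_left]
      simp
    rw [this]
    ring
  simp only [hexp]
  rw [integral_add, integral_add, integral_const_mul, integral_const_mul, hcross, expMoment]
  · ring
  all_goals exact Continuous.integrable_of_ae_norm_eq_one hs (by fun_prop)

lemma expMoment_relation (hs : ∀ᵐ x ∂m, ‖x‖ = 1)
    (hinv : ∀ O : E ≃ₗᵢ[ℝ] E, m.map O = m) {u : E} (hu : ‖u‖ = 1) {p : ℕ}
    (hdim : Module.finrank ℝ E = p + 1) (t : ℝ) :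
    t * (expMoment m u 0 t - expMoment m u 2 t) = p * expMoment m u 1 t := by
  let b := stdOrthonormalBasis ℝ E
  have hsum : ∑ i, t * ∫ x, ⟪b i, x⟫ ^ 2 * Real.exp (t * ⟪u, x⟫) ∂m = t * expMoment m u 0 t := by
    rw [← Finset.mul_sum, ← integral_finsetSum, expMoment]
    · congr 1
      refine integral_congr_ae ?_
      filter_upwards [hs] with x hx
      have h := b.sum_sq_norm_inner_right x
      simp only [Real.norm_eq_abs, sq_abs, hx] at h
      rw [← Finset.sum_mul, h]
      simp
    · intro i _
      exact Continuous.integrable_of_ae_norm_eq_one hs (by fun_prop)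
  have hu' := b.sum_sq_norm_inner_right u
  simp only [Real.norm_eq_abs, sq_abs, hu, one_pow] at hu'
  simp only [integral_inner_sq_mul_exp hs hinv hu, Finset.sum_add_distrib, ← Finset.sum_mul,
    Finset.sum_sub_distrib, hu', b.norm_eq_one] at hsum
  simp [hdim] at hsum
  linarith

lemma variance_tilted_inner_le (hs : ∀ᵐ x ∂m, ‖x‖ = 1)
    (hinv : ∀ O : E ≃ₗᵢ[ℝ] E, m.map O = m) {p : ℕ} (hp : 1 ≤ p)
    (hdim : Module.finrank ℝ E = p + 1) (h : E) {e : E} (he : ‖e‖ = 1) :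
    variance (fun x => ⟪e, x⟫) (m.tilted fun x => ⟪h, x⟫) ≤ 1 / (p + 1) := by
  obtain ⟨u, t, ht, hu, hut, hue⟩ : ∃ (u : E) (t : ℝ), 0 ≤ t ∧ ‖u‖ = 1 ∧ h = t • u ∧
      (t = 0 → u = e) := by
    rcases eq_or_ne h 0 with rfl | hh
    · exact ⟨e, 0, le_rfl, he, by simp, fun _ => rfl⟩
    · have hh' := norm_ne_zero_iff.2 hh
      refine ⟨‖h‖⁻¹ • h, ‖h‖, norm_nonneg h, ?_, ?_, fun h0 => absurd h0 hh'⟩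
      · rw [norm_smul, norm_inv, norm_norm, inv_mul_cancel₀ hh']
      · rw [smul_smul, mul_inv_cancel₀ hh', one_smul]
  have hexp (x : E) : ⟪h, x⟫ = t * ⟪u, x⟫ := by
    rw [hut, inner_smul_left]
    simp
  simp only [hexp]
  have hprob (s : ℝ) : IsProbabilityMeasure (m.tilted fun x => s * ⟪u, x⟫) :=
    isProbabilityMeasure_tilted (Continuous.integrable_of_ae_norm_eq_one hs (by fun_prop))
  have hae (s : ℝ) : ∀ᵐ x ∂(m.tilted fun x => s * ⟪u, x⟫), ‖x‖ = 1 :=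
    (tilted_absolutelyContinuous m _).ae_le hs
  have hvar (s : ℝ) (v : E) : variance (fun x => ⟪v, x⟫) (m.tilted fun x => s * ⟪u, x⟫) =
      (∫ x, ⟪v, x⟫ ^ 2 * Real.exp (s * ⟪u, x⟫) ∂m) / expMoment m u 0 s
        - ((∫ x, ⟪v, x⟫ * Real.exp (s * ⟪u, x⟫) ∂m) / expMoment m u 0 s) ^ 2 := by
    have hmem : MemLp (fun x => ⟪v, x⟫) 2 (m.tilted fun x => s * ⟪u, x⟫) :=
      (memLp_two_iff_integrable_sq (Continuous.aestronglyMeasurable (by fun_prop))).2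
        (Continuous.integrable_of_ae_norm_eq_one (hae s) (by fun_prop))
    rw [variance_eq_sub hmem, integral_tilted, integral_tilted, ← integral_div, ← integral_div]
    simp only [expMoment, pow_zero, one_mul, smul_eq_mul, Pi.pow_apply, mul_comm, mul_div_assoc]
  have hpos (s : ℝ) : 0 < expMoment m u 0 s := by
    simp only [expMoment, pow_zero, one_mul]
    exact integral_exp_pos (Continuous.integrable_of_ae_norm_eq_one hs (by fun_prop))
  have hle (s : ℝ) : expMoment m u 2 s ≤ expMoment m u 0 s := by
    refine integral_mono_ae (Continuous.integrable_of_ae_norm_eq_one hs (by fun_prop))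
      (Continuous.integrable_of_ae_norm_eq_one hs (by fun_prop)) ?_
    filter_upwards [hs] with x hx
    have hux : |⟪u, x⟫| ≤ 1 := by simpa [hu, hx] using abs_real_inner_le_norm u x
    rw [pow_zero]
    gcongr
    exact (sq_le_one_iff_abs_le_one _).2 hux
  have hvar' (s : ℝ) : (expMoment m u 1 s / expMoment m u 0 s) ^ 2
      ≤ expMoment m u 2 s / expMoment m u 0 s := by
    have := hvar s u ▸ variance_nonneg (fun x => ⟪u, x⟫) (m.tilted fun x => s * ⟪u, x⟫)
    simpa [expMoment] using this
  have hd (k : ℕ) := hasDerivAt_expMoment hs u k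
  have hrel := expMoment_relation hs hinv hu hdim
  have hmain := moment_variance_le hp hpos (hd 0) (hd 1) (hd 2) hle hvar' hrel ht
  rw [hvar t e]
  rcases ht.eq_or_lt with rfl | htpos
  · rw [← hue rfl]
    simpa [expMoment] using hmain
  set c : ℝ := ⟪e, u⟫ with hc
  have hc1 : c ^ 2 ≤ 1 := by
    rw [sq_le_one_iff_abs_le_one]
    simpa [hu, he] using abs_real_inner_le_norm e u
  have hlow := le_second_moment hp (hd 0) (hd 1) (hd 2) hle hrel ht
  have hsecond := integral_inner_sq_mul_exp hs hinv hu e t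
  have hfirst : ∫ x, ⟪e, x⟫ * Real.exp (t * ⟪u, x⟫) ∂m = c * expMoment m u 1 t := by
    have h0 := integral_inner_mul_comp_inner_eq_zero hinv (a := u) (v := e - c • u)
      (by rw [inner_sub_left, inner_smul_left, real_inner_self_eq_norm_sq, hu, ← hc]; simp)
      fun y => Real.exp (t * y)
    rw [expMoment, ← integral_const_mul, ← sub_eq_zero, ← integral_sub, ← h0]
    · congr! 2 with x
      rw [inner_sub_left, inner_smul_left]
      simp
      ring
    all_goals exact Continuous.integrable_of_ae_norm_eq_one hs (by fun_prop)
  have hp0 : (0 : ℝ) < p := by exact_mod_cast hp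
  have hM₁ : expMoment m u 1 t / (t * expMoment m u 0 t) ≤ 1 / (p + 1) := by
    rw [div_le_div_iff₀ (mul_pos htpos (hpos t)) (by positivity)]
    refine le_of_mul_le_mul_left ?_ hp0
    have := mul_le_mul_of_nonneg_left hlow ht
    linear_combination this - (p + 1) * hrel t
  have hsecond' : (∫ x, ⟪e, x⟫ ^ 2 * Real.exp (t * ⟪u, x⟫) ∂m) / expMoment m u 0 t =
      c ^ 2 * (expMoment m u 2 t / expMoment m u 0 t)
        + (1 - c ^ 2) * (expMoment m u 1 t / (t * expMoment m u 0 t)) := by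
    have := (hpos t).ne'
    rw [he, ← hc] at hsecond
    field_simp
    linear_combination hsecond
  rw [hsecond', hfirst]
  have h1 := mul_le_mul_of_nonneg_left hmain (sq_nonneg c)
  have h2 := mul_le_mul_of_nonneg_left hM₁ (sub_nonneg.2 hc1)
  linear_combination h1 + h2

end Sphere

/-- On the unit sphere `S^p ⊂ ℝ^{p+1}` with its normalized uniform (rotation-invariant)
probability measure `m`, consider the tilted measure `μ_h(dx) = e^{h·x} m(dx)/Z(h)`.
Then for any unit vector `e`, the variance of the linear functional `x ↦ e·x` under `μ_h`
is at most `1/(p+1)`. -/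
theorem tilted_sphere_linear_variance_le
    (p : ℕ) (hp : 1 ≤ p)
    (m : Measure (EuclideanSpace ℝ (Fin (p + 1)))) [IsProbabilityMeasure m]
    (hsupp : m (Metric.sphere (0 : EuclideanSpace ℝ (Fin (p + 1))) 1) = 1)
    (hinv : ∀ O : EuclideanSpace ℝ (Fin (p + 1)) ≃ₗᵢ[ℝ] EuclideanSpace ℝ (Fin (p + 1)),
      m.map O = m)
    (h : EuclideanSpace ℝ (Fin (p + 1)))
    (Z : ℝ) (hZ : Z = ∫ x, Real.exp ⟪h, x⟫ ∂m)
    (μh : Measure (EuclideanSpace ℝ (Fin (p + 1))))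
    (hμh : μh = m.withDensity fun x => ENNReal.ofReal (Real.exp ⟪h, x⟫ / Z))
    (e : EuclideanSpace ℝ (Fin (p + 1))) (he : ‖e‖ = 1) :
    variance (fun x => ⟪e, x⟫) μh ≤ 1 / (p + 1) := by
  have hs : ∀ᵐ x ∂m, ‖x‖ = 1 := by
    filter_upwards [mem_ae_iff.2
      ((prob_compl_eq_zero_iff Metric.isClosed_sphere.measurableSet).2 hsupp)] with x hx
    simpa using hx
  subst hZ hμh
  exact variance_tilted_inner_le hs hinv hp (by simp) h he
end
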